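/- Let G = ⟨a,b_1,…,b_r⟩ be a multi-GGS-group such that b_1 is defined by a non-constant vector e_1 (there exists i with e_{1,i} ≠ e_{1,i+1}). Then there exists x ∈ G′ ∩ st(1) whose section at the first level-one vertex equals a; consequently, for every i ∈ {1,…,r} there exists y ∈ G′ ∩ st(1) whose section at the first level-one vertex equals b_i. -/

import Mathlib

/-!
Automorphisms of the `p`-regular rooted tree, encoded by portraits:
an automorphism is a family of permutations of `Fin p`, one for each vertex
(vertices are finite words over `Fin p`, the root being `[]`).
-/

namespace TreeAut

variable {p : ℕ}

/-- Automorphisms of the `p`-regular rooted tree, given by their portraits. -/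
def AutT (p : ℕ) : Type := List (Fin p) → Equiv.Perm (Fin p)

namespace AutT

/-- The action of a tree automorphism on the vertices (finite words over `Fin p`). -/
def act : AutT p → List (Fin p) → List (Fin p)
  | _, [] => []
  | f, x :: w => f [] x :: act (fun v => f (x :: v)) w

/-- The section of `f` at the level-one vertex `x`; the map
`f ↦ (sections f 0, …, sections f (p-1))` restricted to the first-level
stabilizer is the isomorphism `ψ`. -/
def sections (f : AutT p) : Fin p → AutT p := fun x v => f (x :: v)

instance : One (AutT p) := ⟨fun _ => 1⟩

instance : Mul (AutT p) := ⟨fun f g v => f (act g v) * g v⟩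

/-- The action of the inverse automorphism on vertices. -/
def invAct : AutT p → List (Fin p) → List (Fin p)
  | _, [] => []
  | f, x :: w => (f [])⁻¹ x :: invAct (fun v => f (((f [])⁻¹ x) :: v)) w

instance : Inv (AutT p) := ⟨fun f v => (f (invAct f v))⁻¹⟩

lemma one_apply (v : List (Fin p)) : (1 : AutT p) v = 1 := rfl

lemma mul_apply (f g : AutT p) (v : List (Fin p)) : (f * g) v = f (act g v) * g v := rfl

lemma inv_apply (f : AutT p) (v : List (Fin p)) : f⁻¹ v = (f (invAct f v))⁻¹ := rfl

lemma act_nil (f : AutT p) : act f [] = [] := rfl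

lemma act_cons (f : AutT p) (x : Fin p) (w : List (Fin p)) :
    act f (x :: w) = f [] x :: act (sections f x) w := rfl

lemma sections_mul (f g : AutT p) (x : Fin p) :
    sections (f * g) x = sections f (g [] x) * sections g x :=
  funext fun _ => rfl

lemma act_one : ∀ v : List (Fin p), act (1 : AutT p) v = v
  | [] => rfl
  | x :: w => congrArg (x :: ·) (act_one w)

lemma act_mul (f g : AutT p) : ∀ v : List (Fin p), act (f * g) v = act f (act g v)
  | [] => rfl
  | x :: w => by
      rw [act_cons (f * g), sections_mul, act_mul, act_cons g, act_cons f]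
      rfl

lemma invAct_act (f : AutT p) : ∀ v : List (Fin p), invAct f (act f v) = v
  | [] => rfl
  | x :: w => by
      rw [act_cons]
      show (f [])⁻¹ (f [] x) ::
          invAct (fun v => f (((f [])⁻¹ (f [] x)) :: v)) (act (sections f x) w) = x :: w
      have h : (f [])⁻¹ (f [] x) = x := (f []).symm_apply_apply x
      refine (congrArg (fun y : Fin p =>
        y :: invAct (fun v => f (y :: v)) (act (sections f x) w)) h).trans ?_
      exact congrArg (x :: ·) (invAct_act (sections f x) w)

instance : Group (AutT p) where
  mul_assoc f g h := by
    funext v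
    show (f * g) (act h v) * h v = f (act (g * h) v) * (g * h) v
    rw [mul_apply, mul_apply, act_mul, mul_assoc]
  one_mul f := by
    funext v
    show (1 : AutT p) (act f v) * f v = f v
    rw [one_apply, one_mul]
  mul_one f := by
    funext v
    show f (act (1 : AutT p) v) * (1 : AutT p) v = f v
    rw [act_one, one_apply, mul_one]
  inv_mul_cancel f := by
    funext v
    show f⁻¹ (act f v) * f v = (1 : AutT p) v
    rw [inv_apply, invAct_act, one_apply, inv_mul_cancel]

lemma act_length (f : AutT p) : ∀ v : List (Fin p), (act f v).length = v.length
  | [] => rfl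
  | _ :: w => congrArg Nat.succ (act_length _ w)

lemma act_act_inv (f : AutT p) (v : List (Fin p)) : act f (act f⁻¹ v) = v := by
  rw [← act_mul, mul_inv_cancel, act_one]

/-- The pointwise stabilizer `st(n)` of the `n`-th level of the tree. -/
def levelStab (p n : ℕ) : Subgroup (AutT p) where
  carrier := {f | ∀ v : List (Fin p), v.length = n → act f v = v}
  one_mem' := fun v _ => act_one v
  mul_mem' := by
    intro f g hf hg v hv
    rw [act_mul, hg v hv, hf v hv]
  inv_mem' := by
    intro f hf v hv
    have h1 : act f (act f⁻¹ v) = v := act_act_inv f v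
    have h2 : act f (act f⁻¹ v) = act f⁻¹ v := hf _ (by rw [act_length, hv])
    exact h2.symm.trans h1

instance levelStab_normal (p n : ℕ) : (levelStab p n).Normal := by
  constructor
  intro f hf g v hv
  show act (g * f * g⁻¹) v = v
  rw [act_mul, act_mul, hf _ (by rw [act_length, hv]), act_act_inv]

/-- The tuple of sections at the level-two vertices.  Restricted to the
second-level stabilizer this is the map `ψ₂`. -/
def sections2 (f : AutT p) : Fin p → Fin p → AutT p := fun x y v => f (x :: y :: v)

/-- The rooted automorphism defined by a permutation `σ` of `Fin p`. -/
def rooted (σ : Equiv.Perm (Fin p)) : AutT p := fun v => if v = [] then σ else 1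

/-- The rooted automorphism `a`, acting at the root by the cycle `(1 2 … p)`. -/
def rootedA (p : ℕ) : AutT p := rooted (finRotate p)

/-- Auxiliary portrait for the directed automorphism `b_e`. -/
def directedAux (e : Fin (p - 1) → ZMod p) : List (Fin p) → Equiv.Perm (Fin p)
  | [] => 1
  | x :: w =>
      if h : (x : ℕ) < p - 1 then
        (if w = [] then finRotate p ^ ((e ⟨x, h⟩).val) else 1)
      else directedAux e w

/-- The directed automorphism `b_e` defined by the vector `e ∈ 𝔽_p^{p-1}`,
i.e. the unique automorphism with `ψ(b_e) = (a^{e_1}, …, a^{e_{p-1}}, b_e)`. -/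
def directed (e : Fin (p - 1) → ZMod p) : AutT p := directedAux e

/-- The multi-GGS-group determined by the vectors `e 1, …, e r`. -/
def multiGGS (p : ℕ) {r : ℕ} (e : Fin r → Fin (p - 1) → ZMod p) : Subgroup (AutT p) :=
  Subgroup.closure ({rootedA p} ∪ Set.range fun i => directed (e i))

/-- The GGS-group `𝒢` defined by the (nonzero) constant vector `(c, …, c)`. -/
def constGGS (p : ℕ) (c : ZMod p) : Subgroup (AutT p) :=
  Subgroup.closure {rootedA p, directed (fun _ => c)}

/-- `G` is the GGS-group `𝒢` defined by a constant vector. -/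
def IsConstGGS {p : ℕ} (G : Subgroup (AutT p)) : Prop :=
  ∃ c : ZMod p, c ≠ 0 ∧ G = constGGS p c

/-- The stabilizer `st_G(n) = G ∩ st(n)`, viewed as a subgroup of `G`. -/
def stabIn {p : ℕ} (G : Subgroup (AutT p)) (n : ℕ) : Subgroup G :=
  (levelStab p n).comap G.subtype

instance {p : ℕ} (G : Subgroup (AutT p)) (n : ℕ) : (stabIn G n).Normal :=
  Subgroup.Normal.comap (levelStab_normal p n) G.subtype

/-- The congruence subgroup property: every finite-index subgroup of `G`
contains a level stabilizer `st_G(n)`. -/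
def HasCSP {p : ℕ} (G : Subgroup (AutT p)) : Prop :=
  ∀ H : Subgroup G, H.FiniteIndex → ∃ n : ℕ, stabIn G n ≤ H

/-- `G` is just infinite: it is infinite and all its nontrivial normal
subgroups have finite index. -/
def JustInfinite {p : ℕ} (G : Subgroup (AutT p)) : Prop :=
  Infinite G ∧ ∀ N : Subgroup G, N.Normal → N ≠ ⊥ → N.FiniteIndex

end AutT

end TreeAut

open TreeAut AutT Subgroup

namespace TreeAut.AutT

variable {p : ℕ}

lemma root_eq_one_of_mem_levelStab_one {f : AutT p} (hf : f ∈ levelStab p 1) : f [] = 1 := by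
  ext x
  have h := hf [x] rfl
  rw [act_cons, act_nil] at h
  simpa using congrArg Fin.val (List.cons.inj h).1

lemma mem_levelStab_one_of_root_eq_one {f : AutT p} (hf : f [] = 1) : f ∈ levelStab p 1 := by
  intro v hv
  obtain ⟨x, rfl⟩ := List.length_eq_one_iff.mp hv
  rw [act_cons, act_nil, hf, Equiv.Perm.one_apply]

/-- Taking the section at a level-one vertex is a homomorphism on the first-level stabilizer. -/
def sectionHom (x : Fin p) : levelStab p 1 →* AutT p where
  toFun f := sections f.1 x
  map_one' := rfl
  map_mul' f g := by
    change sections (f.1 * g.1) x = _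
    rw [sections_mul, root_eq_one_of_mem_levelStab_one g.2, Equiv.Perm.one_apply]

/-- The sections at `x` of the elements of `K` that stabilize the first level. -/
def sectionSubgroup (K : Subgroup (AutT p)) (x : Fin p) : Subgroup (AutT p) :=
  (K.subgroupOf (levelStab p 1)).map (sectionHom x)

lemma mem_sectionSubgroup {K : Subgroup (AutT p)} {x : Fin p} {g : AutT p} :
    g ∈ sectionSubgroup K x ↔ ∃ f ∈ (K ⊓ levelStab p 1 : Subgroup (AutT p)),
      sections f x = g := by
  constructor
  · rintro ⟨f, hf, rfl⟩
    exact ⟨f.1, ⟨hf, f.2⟩, rfl⟩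
  · rintro ⟨f, ⟨hK, hst⟩, rfl⟩
    exact ⟨⟨f, hst⟩, hK, rfl⟩

lemma rooted_one : rooted (1 : Equiv.Perm (Fin p)) = 1 := by
  funext v
  simp [rooted, one_apply]

lemma rooted_mul (σ τ : Equiv.Perm (Fin p)) : rooted (σ * τ) = rooted σ * rooted τ := by
  funext v
  rw [mul_apply]
  cases v with
  | nil => rfl
  | cons x w => simp [rooted, act_cons]

/-- `rooted` as a homomorphism. -/
def rootedHom (p : ℕ) : Equiv.Perm (Fin p) →* AutT p where
  toFun := rooted
  map_one' := rooted_one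
  map_mul' := rooted_mul

lemma rootedA_pow (k : ℕ) : rootedA p ^ k = rooted (finRotate p ^ k) :=
  (map_pow (rootedHom p) (finRotate p) k).symm

lemma rooted_inv (σ : Equiv.Perm (Fin p)) : (rooted σ)⁻¹ = rooted σ⁻¹ :=
  (map_inv (rootedHom p) σ).symm

lemma sections_rooted (σ : Equiv.Perm (Fin p)) (x : Fin p) : sections (rooted σ) x = 1 :=
  rfl

lemma rooted_conj_root {f : AutT p} (hf : f [] = 1) (σ : Equiv.Perm (Fin p)) :
    ((rooted σ)⁻¹ * f * rooted σ) [] = 1 := by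
  simp [rooted_inv, mul_apply, act_nil, hf, rooted]

lemma sections_rooted_conj {f : AutT p} (σ : Equiv.Perm (Fin p)) (x : Fin p) :
    sections ((rooted σ)⁻¹ * f * rooted σ) x = sections f (σ x) := by
  rw [rooted_inv, sections_mul, sections_mul, sections_rooted, sections_rooted, one_mul, mul_one]
  rfl

lemma finRotate_pow_apply_zero (hp : 0 < p) {k : ℕ} (hk : k < p) :
    (finRotate p ^ k) ⟨0, hp⟩ = ⟨k, hk⟩ := by
  induction k with
  | zero => rfl
  | succ k ih =>
    obtain ⟨n, rfl⟩ := Nat.exists_eq_succ_of_ne_zero hp.ne'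
    rw [pow_succ', Equiv.Perm.mul_apply, ih (by omega)]
    exact finRotate_of_lt (by omega)

lemma finRotate_pow_self (hp : 2 ≤ p) : finRotate p ^ p = 1 := by
  obtain ⟨n, rfl⟩ := Nat.exists_eq_add_of_le' hp
  have h := isCycle_finRotate (n := n) |>.orderOf
  rw [support_finRotate, Finset.card_univ, Fintype.card_fin] at h
  simpa [h] using pow_orderOf_eq_one (finRotate (n + 2))

lemma sections_directed_of_lt (e : Fin (p - 1) → ZMod p) (x : Fin p) (h : (x : ℕ) < p - 1) :
    sections (directed e) x = rootedA p ^ (e ⟨x, h⟩).val := by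
  rw [rootedA_pow]
  funext w
  simp [sections, directed, directedAux, h, rooted]

lemma sections_directed_last (e : Fin (p - 1) → ZMod p) (x : Fin p) (h : ¬ (x : ℕ) < p - 1) :
    sections (directed e) x = directed e := by
  funext w
  simp [sections, directed, directedAux, h]

/-- Comparing two conjugates of `f` by powers of `a` inside the commutator subgroup. -/
lemma sections_mul_inv_mem_commutator {G : Subgroup (AutT p)} (ha : rootedA p ∈ G) {f : AutT p}
    (hf : f ∈ G) (hroot : f [] = 1) (hp : 0 < p) (x y : Fin p) :
    sections f x * (sections f y)⁻¹ ∈ sectionSubgroup ⁅G, G⁆ ⟨0, hp⟩ := by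
  have hcomm (k : ℕ) : (rootedA p ^ k)⁻¹ * f * rootedA p ^ k * f⁻¹ ∈ ⁅G, G⁆ := by
    simpa [commutatorElement_def] using
      Subgroup.commutator_mem_commutator (inv_mem (pow_mem ha k)) hf
  have hst (k : ℕ) : (rootedA p ^ k)⁻¹ * f * rootedA p ^ k ∈ levelStab p 1 := by
    rw [rootedA_pow]
    exact mem_levelStab_one_of_root_eq_one (rooted_conj_root hroot _)
  have hsec (z : Fin p) :
      sectionHom ⟨0, hp⟩ ⟨_, hst z⟩ = sections f z := by
    change sections ((rootedA p ^ (z : ℕ))⁻¹ * f * rootedA p ^ (z : ℕ)) _ = _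
    rw [rootedA_pow, sections_rooted_conj, finRotate_pow_apply_zero hp z.2]
  refine ⟨⟨_, hst x⟩ * ⟨_, hst y⟩⁻¹, ?_, ?_⟩
  · have h := mul_mem (hcomm x) (inv_mem (hcomm y))
    simp only [SetLike.mem_coe, Subgroup.mem_subgroupOf]
    convert h using 1
    simp only [Subgroup.coe_mul, Subgroup.coe_inv]
    group
  · rw [map_mul, map_inv, hsec, hsec]

end TreeAut.AutT

/-- If `b₁` is defined by a non-constant vector, then some `x ∈ G' ∩ st(1)`
has section `a` at the first level-one vertex, and consequently for every `i`
some `y ∈ G' ∩ st(1)` has section `b_i` at the first level-one vertex. -/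
theorem exists_section_rooted_and_directed
    (p r : ℕ) (hp : p.Prime) (hpodd : Odd p) (hr : 1 ≤ r)
    (e : Fin r → Fin (p - 1) → ZMod p) (he : LinearIndependent (ZMod p) e)
    (hnc : ∃ (i : Fin (p - 1)) (h : (i : ℕ) + 1 < p - 1),
      e ⟨0, hr⟩ i ≠ e ⟨0, hr⟩ ⟨(i : ℕ) + 1, h⟩) :
    (∃ x ∈ (⁅multiGGS p e, multiGGS p e⁆ ⊓ levelStab p 1 : Subgroup (AutT p)),
        sections x ⟨0, hp.pos⟩ = rootedA p) ∧
    ∀ i : Fin r, ∃ y ∈ (⁅multiGGS p e, multiGGS p e⁆ ⊓ levelStab p 1 : Subgroup (AutT p)),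
        sections y ⟨0, hp.pos⟩ = directed (e i) := by
  have : Fact p.Prime := ⟨hp⟩
  have hp2 := hp.two_le
  have hamem : rootedA p ∈ multiGGS p e := subset_closure (Or.inl rfl)
  have hbmem (i : Fin r) : directed (e i) ∈ multiGGS p e := subset_closure (Or.inr ⟨i, rfl⟩)
  have hquot (i : Fin r) (x y : Fin p) := sections_mul_inv_mem_commutator hamem (hbmem i) rfl
    hp.pos x y
  simp only [← mem_sectionSubgroup]
  set S := sectionSubgroup ⁅multiGGS p e, multiGGS p e⁆ ⟨0, hp.pos⟩
  have hrooted : rootedA p ∈ S := by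
    obtain ⟨i, h, hne⟩ := hnc
    have hmem := hquot ⟨0, hr⟩ ⟨i, by omega⟩ ⟨i + 1, by omega⟩
    rw [sections_directed_of_lt _ _ i.2, sections_directed_of_lt _ _ h] at hmem
    set u := e ⟨0, hr⟩ i
    set v := e ⟨0, hr⟩ ⟨(i : ℕ) + 1, h⟩
    have hpow : rootedA p ^ ((u.val : ℤ) - v.val) ∈ S := by
      rw [zpow_sub, zpow_natCast, zpow_natCast]
      exact hmem
    have hperiod : rootedA p ^ (p : ℤ) = 1 := by
      rw [zpow_natCast, rootedA_pow, finRotate_pow_self hp2, rooted_one]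
    have hcop : IsCoprime (p : ℤ) ((u.val : ℤ) - v.val) := by
      rw [(Nat.prime_iff_prime_int.mp hp).coprime_iff_not_dvd,
        ← ZMod.intCast_zmod_eq_zero_iff_dvd]
      simpa [sub_eq_zero] using hne
    obtain ⟨s, t, hst⟩ := hcop
    rw [← zpow_one (rootedA p), ← hst, zpow_add, mul_comm s, mul_comm t, zpow_mul, zpow_mul,
      hperiod, one_zpow, one_mul]
    exact zpow_mem hpow t
  refine ⟨hrooted, fun i => ?_⟩
  have h0 : 0 < p - 1 := by omega
  have hmem := hquot i ⟨p - 1, by omega⟩ ⟨0, hp.pos⟩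
  rw [sections_directed_last _ _ (lt_irrefl _), sections_directed_of_lt _ _ h0] at hmem
  simpa using mul_mem hmem (pow_mem hrooted (e i ⟨0, h0⟩).val)
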